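/- Let n ≥ 3 be an integer, λ_max ∈ [0,1), p_min ∈ (0,1), ε ∈ (0,1), and suppose n ≥ N_0 := max{exp(60·(1−λ_max)^{−2}), 3/p_min, sqrt(log(2/ε²)/log n)}. Define θ := e^{−100}·exp(10·log(ε/2)/log n)·exp(−140·(1−λ_max)^{−2})·p_min/log n, T^FD := ⌈(e/θ)^{5(1−λ_max)^{−2}}·(2·log n + log log(2/p_min) + log(2/ε²))⌉, and p*_min := p_min/(p_min + θ·(1−p_min)). Then (1 − p*_min)·log n ≤ min{e^{−40}·exp(−5·log(2·T^FD/ε)/log n), (1 − λ_max)/27}. -/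

import Mathlib

set_option maxHeartbeats 4000000

/-- **Lemma C.4 (parameter verification).** Under the parameterization of Table 1, the tilted
random cluster instances passed to the parallel Glauber simulation satisfy the
low-temperature condition of Theorem 4.3. -/
theorem parameter_verification
    (n : ℕ) (hn3 : 3 ≤ n)
    (lammax : ℝ) (hlam : lammax ∈ Set.Ico (0 : ℝ) 1)
    (pmin : ℝ) (hpmin : pmin ∈ Set.Ioo (0 : ℝ) 1)
    (ε : ℝ) (hε : ε ∈ Set.Ioo (0 : ℝ) 1)
    (hN0 : max (max (Real.exp (60 * ((1 - lammax) ^ 2)⁻¹)) (3 / pmin))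
        (Real.sqrt (Real.log (2 / ε ^ 2) / Real.log n)) ≤ (n : ℝ))
    (θ : ℝ)
    (hθ : θ = Real.exp (-100) * Real.exp (10 * Real.log (ε / 2) / Real.log n) *
        Real.exp (-140 * ((1 - lammax) ^ 2)⁻¹) * pmin / Real.log n)
    (TFD : ℕ)
    (hTFD : TFD = Nat.ceil ((Real.exp 1 / θ) ^ (5 * ((1 - lammax) ^ 2)⁻¹) *
        (2 * Real.log n + Real.log (Real.log (2 / pmin)) + Real.log (2 / ε ^ 2))))
    (pstarmin : ℝ)
    (hpstar : pstarmin = pmin / (pmin + θ * (1 - pmin))) :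
    (1 - pstarmin) * Real.log n ≤
      min (Real.exp (-40) *
            Real.exp (-(5 * Real.log (2 * (TFD : ℝ) / ε)) / Real.log n))
          ((1 - lammax) / 27) := by
  obtain ⟨hl0, hl1⟩ := hlam
  obtain ⟨hp0, hp1⟩ := hpmin
  obtain ⟨he0, he1⟩ := hε
  have hN1 := (le_max_left _ _).trans ((le_max_left _ _).trans hN0)
  have hN2 := (le_max_right _ _).trans ((le_max_left _ _).trans hN0)
  have hN3 := (le_max_right _ _).trans hN0
  have hn0 : (0 : ℝ) < n := by
    have : 0 < n := by omega
    exact_mod_cast this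
  have hn1 : (3 : ℝ) ≤ n := by exact_mod_cast hn3
  set L := Real.log n with hL
  have hd0 : 0 < 1 - lammax := by linarith
  have hdg : (1 - lammax) ^ 2 * ((1 - lammax) ^ 2)⁻¹ = 1 := mul_inv_cancel₀ (by positivity)
  have hg1 : 1 ≤ ((1 - lammax) ^ 2)⁻¹ := by
    rw [one_le_inv₀ (by positivity)]
    nlinarith
  set g := ((1 - lammax) ^ 2)⁻¹ with hg
  have hLg : 60 * g ≤ L := by
    rw [hL, Real.le_log_iff_exp_le hn0]; exact hN1
  have hL60 : 60 ≤ L := by linarith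
  have hL0 : 0 < L := by linarith
  set E := -Real.log (ε / 2) with hE
  have hE0 : 0 < E := by
    have : Real.log (ε / 2) < 0 := Real.log_neg (by positivity) (by linarith)
    linarith
  set Q := E / L with hQ
  have hQ0 : 0 < Q := by positivity
  have hQL : Q * L = E := by rw [hQ]; field_simp
  have hθ' : θ = Real.exp (-100 - 10 * Q - 140 * g) * pmin / L := by
    rw [hθ, ← Real.exp_add, ← Real.exp_add]
    congr 3
    rw [hQ, hE]; ring
  have hθ0 : 0 < θ := by rw [hθ']; positivity
  have hmain : (1 - pstarmin) * L ≤ Real.exp (-100 - 10 * Q - 140 * g) := by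
    have hden : 0 < pmin + θ * (1 - pmin) := by
      have := mul_pos hθ0 (sub_pos.2 hp1); linarith
    have h1 : 1 - pstarmin ≤ θ / pmin := by
      rw [hpstar, one_sub_div hden.ne', div_le_div_iff₀ hden hp0]
      have := mul_pos hθ0 (sub_pos.2 hp1)
      have := mul_pos hθ0 this
      have := mul_pos (mul_pos hθ0 hp0) hp0
      nlinarith
    calc (1 - pstarmin) * L ≤ θ / pmin * L := by gcongr
      _ = _ := by rw [hθ']; field_simp
  refine hmain.trans (le_min ?_ ?_)
  · rw [← Real.exp_add, Real.exp_le_exp]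
    have key : 5 * Real.log (2 * (TFD : ℝ) / ε) ≤ (60 + 10 * Q + 140 * g) * L := by
      rcases Nat.eq_zero_or_pos TFD with h0 | hpos
      · rw [h0]; simp; positivity
      have hT0 : (0 : ℝ) < TFD := by exact_mod_cast hpos
      have hx := hpos
      rw [hTFD, gt_iff_lt, Nat.ceil_pos] at hx
      have hlt := Nat.ceil_lt_add_one hx.le
      rw [← hTFD] at hlt
      have hlogLle : Real.log L ≤ L := (Real.log_le_sub_one_of_pos hL0).trans (by linarith)
      have hlp : -Real.log pmin ≤ L := by
        have h := Real.log_le_log (by positivity) hN2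
        rw [Real.log_div (by norm_num) hp0.ne'] at h
        have := Real.log_pos (show (1 : ℝ) < 3 by norm_num)
        linarith
      have hl2p : Real.log (2 / pmin) ≤ L := by
        apply Real.log_le_log (by positivity)
        refine le_trans ?_ hN2
        gcongr; norm_num
      have hl2p0 : 0 < Real.log (2 / pmin) := by
        apply Real.log_pos
        rw [lt_div_iff₀ hp0]; linarith
      have hll : Real.log (Real.log (2 / pmin)) ≤ L := (Real.log_le_log hl2p0 hl2p).trans hlogLle
      have hle : Real.log (2 / ε ^ 2) ≤ n ^ 2 * L := by
        rw [Real.sqrt_le_left hn0.le, div_le_iff₀ hL0] at hN3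
        exact hN3
      have hLn : L ≤ n := (Real.log_le_sub_one_of_pos hn0).trans (by linarith)
      have hB : 2 * L + Real.log (Real.log (2 / pmin)) + Real.log (2 / ε ^ 2) + 1 ≤ 4 * (n:ℝ) ^ 3 := by
        have h1 : (n:ℝ)^2 * L ≤ n^2 * n := by gcongr
        have h2 : (9:ℝ) * n ≤ n^2 * n := by
          have : (9:ℝ) ≤ n^2 := by nlinarith
          gcongr
        nlinarith
      have hlogθ : Real.log (Real.exp 1 / θ) = 101 + 10 * Q + 140 * g - Real.log pmin + Real.log L := by
        rw [Real.log_div (by positivity) hθ0.ne', hθ', Real.log_div (by positivity) hL0.ne',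
          Real.log_mul (by positivity) hp0.ne', Real.log_exp, Real.log_exp]
        ring
      have hlogL0 : 0 ≤ Real.log L := Real.log_nonneg (by linarith)
      have hlp0 : Real.log pmin ≤ 0 := Real.log_nonpos hp0.le hp1.le
      have heθ : 0 < Real.exp 1 / θ := by positivity
      have hA1 : 1 ≤ (Real.exp 1 / θ) ^ (5 * g) := by
        apply Real.one_le_rpow _ (by positivity)
        rw [← Real.log_nonneg_iff heθ, hlogθ]
        linarith
      have hlogA : Real.log ((Real.exp 1 / θ) ^ (5 * g)) =
          5 * g * (101 + 10 * Q + 140 * g - Real.log pmin + Real.log L) := by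
        rw [Real.log_rpow heθ, hlogθ]
      set A := (Real.exp 1 / θ) ^ (5 * g) with hA
      have hTA : (TFD : ℝ) ≤ A * (4 * (n:ℝ) ^ 3) := by
        have := mul_le_mul_of_nonneg_left hB (zero_le_one.trans hA1)
        linarith
      have hlogT : Real.log TFD ≤ Real.log A + (4 * L) := by
        have h := Real.log_le_log hT0 hTA
        rw [Real.log_mul (by positivity) (by positivity),
          Real.log_mul (by positivity) (by positivity), Real.log_pow] at h
        have h4 := Real.log_le_sub_one_of_pos (show (0:ℝ) < 4 by norm_num)
        push_cast at h
        linarith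
      have hsplit : Real.log (2 * (TFD : ℝ) / ε) = Real.log TFD + E := by
        rw [hE, Real.log_div (by positivity) (by positivity), Real.log_mul (by positivity) (by positivity),
          Real.log_div (by positivity) (by positivity)]
        ring
      have hg0 : 0 < g := by linarith
      have i1 := mul_le_mul_of_nonneg_left hLg hg0.le
      have i2 := mul_le_mul_of_nonneg_left hLg hQ0.le
      have i3 := mul_le_mul_of_nonneg_left hlp hg0.le
      have i4 := mul_le_mul_of_nonneg_left hlogLle hg0.le
      have i5 := mul_le_mul_of_nonneg_right hg1 hL0.le
      rw [hlogA] at hlogT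
      rw [hsplit]
      nlinarith
    have := (div_le_iff₀ hL0).2 key
    rw [neg_div]
    linarith
  · have h1 : Real.exp (-100 - 10 * Q - 140 * g) ≤ Real.exp (-(140 * g)) := by
      rw [Real.exp_le_exp]; linarith
    refine h1.trans ?_
    have h2 : 140 * g ≤ Real.exp (140 * g) := by
      have := Real.add_one_le_exp (140 * g); linarith
    have hg0 : 0 < g := by linarith
    rw [Real.exp_neg]
    refine (inv_anti₀ (by positivity) h2).trans ?_
    rw [hg, mul_inv, inv_inv]
    nlinarith
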